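/- Endpoint second-variation inequality (log-concave target). Let n ≥ 1 be an integer and d a real with n ≤ d < ∞. Let V, W : ℝⁿ → ℝ be smooth with V > −d pointwise, let Z_V, Z_W > 0 be constants, and let φ : ℝⁿ → ℝ be smooth and convex such that for every x ∈ ℝⁿ the equation (Z_V/Z_W)^{1/d} · det(D²φ(x))^{1/d} = exp( (W(∇φ(x)) − Θ_d(V(x)))/d ) holds. Assume the function (x, e) ↦ ⟨D²φ(x)e, e⟩ on ℝⁿ × S^{n−1} attains its maximum at (x̄, e₁). Set ȳ = ∇φ(x̄), λ = ⟨D²φ(x̄)e₁, e₁⟩, V₁₁ = ⟨D²V(x̄)e₁, e₁⟩, W₁₁ = ⟨D²W(ȳ)e₁, e₁⟩. Then (1 + V(x̄)/d)·W₁₁·λ² ≤ V₁₁. -/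

import Mathlib

open MeasureTheory Metric Set
open scoped ENNReal RealInnerProductSpace

noncomputable section

/-- Euclidean space `ℝⁿ`. -/
abbrev Euc (n : ℕ) := EuclideanSpace ℝ (Fin n)

/-- The second directional derivative `⟨D²f(x)v, v⟩`. -/
def hess {n : ℕ} (f : Euc n → ℝ) (x v : Euc n) : ℝ :=
  iteratedFDeriv ℝ 2 f x ![v, v]

/-- The normalization constant `Z_{U,p} = ∫ (1 + U(x)/p)^(−p) dx`. -/
def Znorm {n : ℕ} (U : Euc n → ℝ) (p : ℝ) : ℝ :=
  ∫ x, (1 + U x / p) ^ (-p)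

/-- The measure `μ_{U,p}` with density `Z_{U,p}⁻¹ (1 + U(x)/p)^(−p)` w.r.t. Lebesgue. -/
def muUP {n : ℕ} (U : Euc n → ℝ) (p : ℝ) : Measure (Euc n) :=
  volume.withDensity fun x => ENNReal.ofReal ((Znorm U p)⁻¹ * (1 + U x / p) ^ (-p))

/-- The ratio `(p + U(x))/(p + |x|²)`. -/
def ratio0 {n : ℕ} (U : Euc n → ℝ) (p : ℝ) (x : Euc n) : ℝ :=
  (p + U x) / (p + ‖x‖ ^ 2)

/-- The ratio `|∇U(x)|²/(√p + |x|)²`. -/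
def ratio1 {n : ℕ} (U : Euc n → ℝ) (p : ℝ) (x : Euc n) : ℝ :=
  ‖gradient U x‖ ^ 2 / (Real.sqrt p + ‖x‖) ^ 2

/-- `c⁽⁰⁾_{U,p}(S) = inf_{x ∈ S} (p + U(x))/(p + |x|²)`. -/
def cLow {n : ℕ} (U : Euc n → ℝ) (p : ℝ) (S : Set (Euc n)) : ℝ := sInf (ratio0 U p '' S)

/-- `C⁽⁰⁾_{U,p}(S) = sup_{x ∈ S} (p + U(x))/(p + |x|²)`. -/
def cUp {n : ℕ} (U : Euc n → ℝ) (p : ℝ) (S : Set (Euc n)) : ℝ := sSup (ratio0 U p '' S)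

/-- `C⁽¹⁾_{U,p}(S) = sup_{x ∈ S} |∇U(x)|²/(√p + |x|)²`. -/
def cGrad {n : ℕ} (U : Euc n → ℝ) (p : ℝ) (S : Set (Euc n)) : ℝ := sSup (ratio1 U p '' S)

/-- The Lebesgue volume of the unit ball in `ℝⁿ`. -/
def unitBallVol (n : ℕ) : ℝ := (volume (ball (0 : Euc n) 1)).toReal

/-- `Θ_p(t) = p·log(1 + t/p)`. -/
def Theta (p t : ℝ) : ℝ := p * Real.log (1 + t / p)

/-- The Hessian matrix of `f` at `x` in the standard orthonormal basis of `ℝⁿ`. -/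
def hessMat {n : ℕ} (f : Euc n → ℝ) (x : Euc n) : Matrix (Fin n) (Fin n) ℝ :=
  Matrix.of fun i j =>
    iteratedFDeriv ℝ 2 f x ![EuclideanSpace.single i 1, EuclideanSpace.single j 1]

/-- Directional derivative. -/
def dirD {n : ℕ} {F : Type*} [NormedAddCommGroup F] [NormedSpace ℝ F]
    (v : Euc n) (f : Euc n → F) (x : Euc n) : F := fderiv ℝ f x v

section helpers

variable {n : ℕ} {F : Type*} [NormedAddCommGroup F] [NormedSpace ℝ F]

theorem two_le_smooth : minSmoothness ℝ 2 ≤ ((⊤ : ℕ∞) : WithTop ℕ∞) := by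
  simp only [minSmoothness_of_isRCLikeNormedField]
  exact WithTop.coe_le_coe.2 (le_top : (2 : ℕ∞) ≤ ⊤)

theorem dirD_smooth {f : Euc n → F} (hf : ContDiff ℝ (⊤ : ℕ∞) f) (v : Euc n) :
    ContDiff ℝ (⊤ : ℕ∞) (dirD v f) := by
  have h : ContDiff ℝ (⊤ : ℕ∞) (fderiv ℝ f) := hf.fderiv_right (by simp)
  exact h.clm_apply contDiff_const

theorem dirD_diff {f : Euc n → F} (hf : ContDiff ℝ (⊤ : ℕ∞) f) : Differentiable ℝ f :=
  hf.differentiable (by simp)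

theorem dirD_dirD {f : Euc n → F} (hf : ContDiff ℝ (⊤ : ℕ∞) f) (v w x : Euc n) :
    dirD v (dirD w f) x = fderiv ℝ (fderiv ℝ f) x v w := by
  have h : ContDiff ℝ (⊤ : ℕ∞) (fderiv ℝ f) := hf.fderiv_right (by simp)
  have h1 : HasFDerivAt (fun y => fderiv ℝ f y w) _ x :=
    ((h.differentiable (by simp)) x).hasFDerivAt.clm_apply (hasFDerivAt_const w x)
  change fderiv ℝ (fun y => fderiv ℝ f y w) x v = _
  rw [h1.fderiv]
  simp

theorem dirD_comm {f : Euc n → F} (hf : ContDiff ℝ (⊤ : ℕ∞) f) (v w : Euc n) :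
    dirD v (dirD w f) = dirD w (dirD v f) := by
  funext x
  rw [dirD_dirD hf, dirD_dirD hf]
  exact (hf.contDiffAt.isSymmSndFDerivAt two_le_smooth) v w

theorem hess_eq {f : Euc n → ℝ} (hf : ContDiff ℝ (⊤ : ℕ∞) f) (x v : Euc n) :
    hess f x v = dirD v (dirD v f) x := by
  rw [dirD_dirD hf]
  simp [hess, iteratedFDeriv_two_apply]

theorem hasDerivAt_line {f : Euc n → F} (hf : ContDiff ℝ (⊤ : ℕ∞) f) (x v : Euc n) (t : ℝ) :
    HasDerivAt (fun s : ℝ => f (x + s • v)) (dirD v f (x + t • v)) t := by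
  have h1 : HasDerivAt (fun s : ℝ => x + s • v) v t := by
    simpa using ((hasDerivAt_id t).smul_const v).const_add x
  exact ((dirD_diff hf) (x + t • v)).hasFDerivAt.comp_hasDerivAt t h1

theorem deriv_line {f : Euc n → F} (hf : ContDiff ℝ (⊤ : ℕ∞) f) (x v : Euc n) :
    deriv (fun s : ℝ => f (x + s • v)) = fun t => dirD v f (x + t • v) :=
  funext fun t => (hasDerivAt_line hf x v t).deriv

theorem dirD_eq_zero_of_max {f : Euc n → ℝ} {x : Euc n} (h : ∀ y, f y ≤ f x) (v : Euc n) :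
    dirD v f x = 0 := by
  have : IsLocalMax f x := Filter.Eventually.of_forall h
  simp [dirD, this.fderiv_eq_zero]

theorem second_test {f : Euc n → ℝ} (hf : ContDiff ℝ (⊤ : ℕ∞) f) {x : Euc n}
    (h : ∀ y, f y ≤ f x) (v : Euc n) : dirD v (dirD v f) x ≤ 0 := by
  by_contra! hpos
  set k : ℝ → ℝ := fun s => f (x + s • v) with hk
  have d1 : deriv k = fun t => dirD v f (x + t • v) := deriv_line hf x v
  have d2 : deriv (deriv k) = fun t => dirD v (dirD v f) (x + t • v) := by
    rw [d1]; exact deriv_line (dirD_smooth hf v) x v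
  have hmin : IsLocalMin k 0 := by
    apply isLocalMin_of_deriv_deriv_pos
    · rw [d2]; simpa using hpos
    · rw [d1]; simpa using dirD_eq_zero_of_max h v
    · exact (hasDerivAt_line hf x v 0).continuousAt
  have hc : k =ᶠ[nhds 0] fun _ => k 0 := by
    filter_upwards [hmin] with t ht
    apply le_antisymm _ ht
    simpa [hk] using h (x + t • v)
  have h2 : deriv (deriv k) 0 = 0 := by
    rw [hc.deriv.deriv_eq]; simp
  rw [d2] at h2
  simp at h2
  linarith

theorem convex_hess {f : Euc n → ℝ} (hf : ContDiff ℝ (⊤ : ℕ∞) f) (hc : ConvexOn ℝ univ f)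
    (x v : Euc n) : 0 ≤ dirD v (dirD v f) x := by
  set k : ℝ → ℝ := fun s => f (x + s • v) with hk
  have hkc : ConvexOn ℝ univ k := by
    refine ⟨convex_univ, fun a _ b _ p q hp hq hpq => ?_⟩
    have := hc.2 (mem_univ (x + a • v)) (mem_univ (x + b • v)) hp hq hpq
    refine le_trans (le_of_eq ?_) this
    simp only [hk]
    congr 1
    have : x = p • x + q • x := by rw [← add_smul, hpq, one_smul]
    nth_rw 1 [this]
    simp only [smul_eq_mul]
    module
  have hm := hkc.monotoneOn_deriv (fun t _ => (hasDerivAt_line hf x v t).differentiableAt)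
  have d1 : deriv k = fun t => dirD v f (x + t • v) := deriv_line hf x v
  have d2 : HasDerivAt (deriv k) (dirD v (dirD v f) (x + (0 : ℝ) • v)) 0 := by
    rw [d1]; exact hasDerivAt_line (dirD_smooth hf v) x v 0
  have h3 : 0 ≤ deriv (deriv k) 0 := by
    rw [← derivWithin_univ]
    exact hm.derivWithin_nonneg
  rw [d2.deriv] at h3
  simpa using h3

theorem log_det_le {m : ℕ} {C : Matrix (Fin m) (Fin m) ℝ} (hC : C.PosDef) :
    Real.log C.det ≤ C.trace - m := by
  have hH := hC.isHermitian
  have hpos := hC.eigenvalues_pos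
  rw [hH.det_eq_prod_eigenvalues, hH.trace_eq_sum_eigenvalues]
  simp only [RCLike.ofReal_real_eq_id, id]
  rw [Real.log_prod (fun i _ => (hpos i).ne')]
  calc ∑ i, Real.log (hH.eigenvalues i) ≤ ∑ i, (hH.eigenvalues i - 1) :=
        Finset.sum_le_sum fun i _ => Real.log_le_sub_one_of_pos (hpos i)
    _ = _ := by simp

open scoped MatrixOrder Matrix.Norms.L2Operator in
theorem exists_normalizer {m : ℕ} {A : Matrix (Fin m) (Fin m) ℝ} (hA : A.PosDef) :
    ∃ B : Matrix (Fin m) (Fin m) ℝ, B * A * B.transpose = 1 := by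
  obtain ⟨B, hB⟩ := (CStarAlgebra.nonneg_iff_eq_star_mul_self (a := A⁻¹)).1 hA.inv.posSemidef.nonneg
  have hdet : IsUnit A.det := hA.det_pos.ne'.isUnit
  have hB' : A⁻¹ = B.transpose * B := by
    rw [hB]; rfl
  refine ⟨B, ?_⟩
  have h1 : B.transpose * (B * A) = 1 := by
    rw [← mul_assoc, ← hB', Matrix.nonsing_inv_mul _ hdet]
  exact mul_eq_one_comm.1 h1

theorem log_det_compare {m : ℕ} {A0 A B : Matrix (Fin m) (Fin m) ℝ} (hA0 : A0.PosDef)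
    (hA : A.PosDef) (hB : B * A0 * B.transpose = 1) :
    Real.log A.det - Real.log A0.det ≤
      (B * A * B.transpose).trace - (B * A0 * B.transpose).trace := by
  have hBu : B.det * A0.det * B.det = 1 := by
    simpa using congrArg Matrix.det hB
  have hBne : B.det ≠ 0 := by
    rintro h; simp [h] at hBu
  have hC : (B * A * B.transpose).PosDef := by
    have h := hA.conjTranspose_mul_mul_same (B := B.transpose)
      (Matrix.mulVec_injective_of_isUnit (by
        rw [Matrix.isUnit_iff_isUnit_det]; simpa using hBne))
    simpa using h
  have h := log_det_le hC
  have h2 : (B * A * B.transpose).det = A.det / A0.det := by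
    have := hA0.det_pos.ne'
    rw [Matrix.det_mul, Matrix.det_mul, Matrix.det_transpose]
    field_simp
    linear_combination A.det * hBu
  rw [h2, Real.log_div hA.det_pos.ne' hA0.det_pos.ne'] at h
  rw [hB]
  simpa using h

/-- The `k`-th row of `B` as a vector. -/
def rowVec (B : Matrix (Fin n) (Fin n) ℝ) (k : Fin n) : Euc n :=
  ∑ i, B k i • EuclideanSpace.single i (1 : ℝ)

theorem hessMat_apply' {f : Euc n → ℝ} (x : Euc n) (i j : Fin n) :
    hessMat f x i j =
      fderiv ℝ (fderiv ℝ f) x (EuclideanSpace.single i 1) (EuclideanSpace.single j 1) := by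
  simp [hessMat, iteratedFDeriv_two_apply]

theorem hessMat_diag {f : Euc n → ℝ} (hf : ContDiff ℝ (⊤ : ℕ∞) f)
    (B : Matrix (Fin n) (Fin n) ℝ) (x : Euc n) :
    (B * hessMat f x * B.transpose).trace =
      ∑ k, dirD (rowVec B k) (dirD (rowVec B k) f) x := by
  rw [Matrix.trace]
  refine Finset.sum_congr rfl fun k _ => ?_
  rw [dirD_dirD hf]
  simp only [rowVec, map_sum, map_smul, _root_.sum_apply,
    _root_.smul_apply, Matrix.diag, Matrix.mul_apply, Matrix.transpose_apply,
    hessMat_apply', smul_eq_mul, Finset.sum_mul]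
  simp only [Finset.mul_sum]
  refine Finset.sum_congr rfl fun i _ => ?_
  refine Finset.sum_congr rfl fun j _ => ?_
  ring

theorem hessMat_posSemidef {f : Euc n → ℝ} (hf : ContDiff ℝ (⊤ : ℕ∞) f)
    (hc : ConvexOn ℝ univ f) (x : Euc n) : (hessMat f x).PosSemidef := by
  refine Matrix.PosSemidef.of_dotProduct_mulVec_nonneg ?_ fun y => ?_
  · ext i j
    simp only [Matrix.conjTranspose_apply, hessMat_apply', star_trivial]
    exact (hf.contDiffAt.isSymmSndFDerivAt two_le_smooth) _ _
  · have h := convex_hess hf hc x (∑ i, y i • EuclideanSpace.single i (1 : ℝ))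
    rw [dirD_dirD hf] at h
    refine h.trans (le_of_eq ?_)
    simp only [map_sum, map_smul, _root_.sum_apply,
      _root_.smul_apply, dotProduct, Matrix.mulVec, star_trivial,
      hessMat_apply', smul_eq_mul]
    simp only [Finset.mul_sum]
    rw [Finset.sum_comm]
    refine Finset.sum_congr rfl fun i _ => Finset.sum_congr rfl fun j _ => ?_
    ring

theorem eigen_of_max {f : Euc n → ℝ} (hf : ContDiff ℝ (⊤ : ℕ∞) f) {x e : Euc n} (he : ‖e‖ = 1)
    (hmax : ∀ u : Euc n, ‖u‖ = 1 → dirD u (dirD u f) x ≤ dirD e (dirD e f) x) (v : Euc n) :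
    dirD e (dirD v f) x = dirD e (dirD e f) x * ⟪e, v⟫ := by
  have hsymm := hf.contDiffAt.isSymmSndFDerivAt (x := x) two_le_smooth
  simp only [dirD_dirD hf] at hmax ⊢
  set Q := fderiv ℝ (fderiv ℝ f) x with hQ
  have hq : ∀ u : Euc n, Q u u ≤ Q e e * ‖u‖ ^ 2 := by
    intro u
    by_cases hu : u = 0
    · simp [hu]
    have hu' : ‖u‖ ≠ 0 := by simpa using hu
    have h := hmax (‖u‖⁻¹ • u) (by rw [norm_smul]; simp [hu'])
    simp only [map_smul, _root_.smul_apply, smul_eq_mul] at h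
    have : 0 < ‖u‖ := lt_of_le_of_ne (norm_nonneg _) hu'.symm
    calc Q u u = (‖u‖⁻¹ * (‖u‖⁻¹ * Q u u)) * ‖u‖ ^ 2 := by field_simp
      _ ≤ _ := by gcongr
  set b := Q e e * ⟪e, v⟫ - Q e v with hb
  set a := Q e e * ‖v‖ ^ 2 - Q v v with ha
  have hs : ∀ s : ℝ, 0 ≤ a * (s * s) + (2 * b) * s + 0 := by
    intro s
    have h := hq (e + s • v)
    have h2 : Q v e = Q e v := hsymm v e
    rw [norm_add_sq_real, norm_smul, inner_smul_right, he] at h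
    simp only [map_add, map_smul, _root_.add_apply, _root_.smul_apply,
      smul_eq_mul, h2, mul_pow, Real.norm_eq_abs, sq_abs] at h
    simp only [ha, hb]
    nlinarith
  have hd := discrim_le_zero hs
  have hb0 : b = 0 := by
    simp only [discrim] at hd
    nlinarith
  linarith

theorem dirD_comp_second {W : Euc n → ℝ} {g : Euc n → Euc n} (hW : ContDiff ℝ (⊤ : ℕ∞) W)
    (hg : ContDiff ℝ (⊤ : ℕ∞) g) (x e : Euc n) (l : ℝ) (h1 : dirD e g x = l • e)
    (h2 : dirD e (dirD e g) x = 0) :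
    dirD e (dirD e (fun y => W (g y))) x = l ^ 2 * dirD e (dirD e W) (g x) := by
  have e1 : dirD e (fun y => W (g y)) = fun y => fderiv ℝ W (g y) (dirD e g y) := by
    funext y
    have := (dirD_diff hW (g y)).hasFDerivAt.comp y (dirD_diff hg y).hasFDerivAt
    change fderiv ℝ (W ∘ g) y e = _
    rw [this.fderiv]; rfl
  have hW' : ContDiff ℝ (⊤ : ℕ∞) (fderiv ℝ W) := hW.fderiv_right (by simp)
  have hc := (dirD_diff hW' (g x)).hasFDerivAt.comp x (dirD_diff hg x).hasFDerivAt
  have hd := hc.clm_apply (dirD_diff (dirD_smooth hg e) x).hasFDerivAt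
  rw [e1, dirD_dirD hW]
  change fderiv ℝ (fun y => (fderiv ℝ W ∘ g) y (dirD e g y)) x e = _
  rw [hd.fderiv]
  have h1' : fderiv ℝ g x e = l • e := h1
  have h2' : fderiv ℝ (dirD e g) x e = 0 := h2
  simp [h1, h1', h2']
  ring

theorem inner_gradient' (f : Euc n → ℝ) (x v : Euc n) : ⟪gradient f x, v⟫ = dirD v f x := by
  rw [gradient, InnerProductSpace.toDual_symm_apply]; rfl

theorem gradient_smooth {f : Euc n → ℝ} (hf : ContDiff ℝ (⊤ : ℕ∞) f) :
    ContDiff ℝ (⊤ : ℕ∞) (gradient f) := by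
  have h : ContDiff ℝ (⊤ : ℕ∞) (fderiv ℝ f) := hf.fderiv_right (by simp)
  exact (InnerProductSpace.toDual ℝ (Euc n)).symm.contDiff.comp h

theorem inner_dirD {g : Euc n → Euc n} (hg : ContDiff ℝ (⊤ : ℕ∞) g) (e v x : Euc n) :
    ⟪dirD e g x, v⟫ = dirD e (fun y => ⟪g y, v⟫) x := by
  have h := (dirD_diff hg x).hasFDerivAt.inner ℝ (hasFDerivAt_const v x)
  change _ = fderiv ℝ (fun y => ⟪g y, v⟫) x e
  rw [h.fderiv]
  simp [dirD]

theorem dirD_sub' {f g : Euc n → ℝ} (hf : ContDiff ℝ (⊤ : ℕ∞) f) (hg : ContDiff ℝ (⊤ : ℕ∞) g)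
    (v : Euc n) : dirD v (fun y => f y - g y) = fun y => dirD v f y - dirD v g y := by
  funext x
  simp only [dirD]
  rw [fderiv_fun_sub (dirD_diff hf x) (dirD_diff hg x)]; rfl

theorem dirD_const_mul {f : Euc n → ℝ} (hf : ContDiff ℝ (⊤ : ℕ∞) f) (c : ℝ)
    (v : Euc n) : dirD v (fun y => c * f y) = fun y => c * dirD v f y := by
  funext x
  simp only [dirD]
  rw [fderiv_const_mul (dirD_diff hf x)]; rfl

theorem dirD_sum {ι : Type*} [Fintype ι] {f : ι → Euc n → ℝ}
    (hf : ∀ k, ContDiff ℝ (⊤ : ℕ∞) (f k))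
    (v : Euc n) : dirD v (fun y => ∑ k, f k y) = fun y => ∑ k, dirD v (f k) y := by
  funext x
  simp only [dirD]
  rw [fderiv_fun_sum (fun k _ => dirD_diff (hf k) x)]
  simp

end helpers

/-- **Endpoint second-variation inequality (log-concave target, `D = ∞`).** -/
theorem endpoint_second_variation
    {n : ℕ} (hn : 1 ≤ n) (d : ℝ) (hnd : (n : ℝ) ≤ d)
    (V W : Euc n → ℝ) (hVreg : ContDiff ℝ (⊤ : ℕ∞) V) (hWreg : ContDiff ℝ (⊤ : ℕ∞) W)
    (hVlow : ∀ x, -d < V x)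
    (ZV ZW : ℝ) (hZV : 0 < ZV) (hZW : 0 < ZW)
    (φ : Euc n → ℝ) (hφreg : ContDiff ℝ (⊤ : ℕ∞) φ) (hφconv : ConvexOn ℝ univ φ)
    (hMA : ∀ x : Euc n, (ZV / ZW) ^ (1 / d) * (hessMat φ x).det ^ (1 / d)
      = Real.exp ((W (gradient φ x) - Theta d (V x)) / d))
    (xbar e1 : Euc n) (he1 : ‖e1‖ = 1)
    (hmax : ∀ (x e : Euc n), ‖e‖ = 1 → hess φ x e ≤ hess φ xbar e1)
    (ybar : Euc n) (hybar : ybar = gradient φ xbar)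
    (l V11 W11 : ℝ)
    (hl : l = hess φ xbar e1)
    (hV11 : V11 = hess V xbar e1) (hW11 : W11 = hess W ybar e1) :
    (1 + V xbar / d) * W11 * l ^ 2 ≤ V11 := by
  have hd : 0 < d := by
    have : (1 : ℝ) ≤ n := by exact_mod_cast hn
    linarith
  have hZ : 0 < ZV / ZW := div_pos hZV hZW
  have hpd : ∀ x, (hessMat φ x).PosDef := by
    intro x
    have hs := hessMat_posSemidef hφreg hφconv x
    rw [hs.posDef_iff_det_ne_zero]
    intro h0
    have h := hMA x
    rw [h0, Real.zero_rpow (by positivity), mul_zero] at h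
    exact (Real.exp_pos _).ne h
  have hlog : ∀ x, Real.log (hessMat φ x).det =
      W (gradient φ x) - Theta d (V x) - Real.log (ZV / ZW) := by
    intro x
    have hdet := (hpd x).det_pos
    have h := congrArg Real.log (hMA x)
    rw [Real.log_exp, Real.log_mul (by positivity) (by positivity), Real.log_rpow hZ,
      Real.log_rpow hdet] at h
    field_simp at h
    linarith
  set c := 1 + V xbar / d with hc
  have hcpos : ∀ x, 0 < 1 + V x / d := by
    intro x
    have : 1 + V x / d = (d + V x) / d := by field_simp
    rw [this]
    exact div_pos (by linarith [hVlow x]) hd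
  have hc0 : 0 < c := hcpos xbar
  have hTheta : ∀ x, Theta d (V x) - Theta d (V xbar) ≤ c⁻¹ * V x - c⁻¹ * V xbar := by
    intro x
    have h := Real.log_le_sub_one_of_pos (div_pos (hcpos x) hc0)
    rw [Real.log_div (hcpos x).ne' hc0.ne'] at h
    have h2 := mul_le_mul_of_nonneg_left h hd.le
    simp only [Theta]
    rw [← hc, ← mul_sub]
    refine h2.trans (le_of_eq ?_)
    have : (1 + V x / d) / c - 1 = (V x / d - V xbar / d) / c := by
      field_simp
      rw [hc]; field_simp; ring
    rw [this]
    field_simp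
  obtain ⟨B, hB⟩ := exists_normalizer (hpd xbar)
  set S : Euc n → ℝ := fun x => ∑ k, dirD (rowVec B k) (dirD (rowVec B k) φ) x with hS
  have hSk : ∀ k, ContDiff ℝ (⊤ : ℕ∞) (dirD (rowVec B k) (dirD (rowVec B k) φ)) := fun k =>
    dirD_smooth (dirD_smooth hφreg _) _
  have hSs : ContDiff ℝ (⊤ : ℕ∞) S := ContDiff.sum fun k _ => hSk k
  have hgs := gradient_smooth hφreg
  have hWg : ContDiff ℝ (⊤ : ℕ∞) (fun x => W (gradient φ x)) := hWreg.comp hgs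
  have hcV : ContDiff ℝ (⊤ : ℕ∞) (fun x => c⁻¹ * V x) := contDiff_const.mul hVreg
  have hWV : ContDiff ℝ (⊤ : ℕ∞) (fun x => W (gradient φ x) - c⁻¹ * V x) := hWg.sub hcV
  have hK : ContDiff ℝ (⊤ : ℕ∞) (fun x => W (gradient φ x) - c⁻¹ * V x - S x) := hWV.sub hSs
  have hKmax : ∀ x, W (gradient φ x) - c⁻¹ * V x - S x ≤
      W (gradient φ xbar) - c⁻¹ * V xbar - S xbar := by
    intro x
    have h := log_det_compare (hpd xbar) (hpd x) hB
    rw [hessMat_diag hφreg, hessMat_diag hφreg, hlog, hlog] at h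
    have h2 := hTheta x
    simp only [hS]
    linarith
  have hK2 := second_test hK hKmax e1
  have hmax' : ∀ x e : Euc n, ‖e‖ = 1 → dirD e (dirD e φ) x ≤ dirD e1 (dirD e1 φ) xbar := by
    intro x e he
    have := hmax x e he
    rwa [hess_eq hφreg, hess_eq hφreg] at this
  have h11s : ContDiff ℝ (⊤ : ℕ∞) (dirD e1 (dirD e1 φ)) := dirD_smooth (dirD_smooth hφreg _) _
  have h11max : ∀ y, dirD e1 (dirD e1 φ) y ≤ dirD e1 (dirD e1 φ) xbar := fun y => hmax' y e1 he1
  have hl' : l = dirD e1 (dirD e1 φ) xbar := by rw [hl, hess_eq hφreg]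
  have hfun : ∀ v, (fun y => ⟪gradient φ y, v⟫) = dirD v φ := fun v =>
    funext fun y => inner_gradient' φ y v
  have hg1 : dirD e1 (gradient φ) xbar = l • e1 := by
    apply ext_inner_right ℝ
    intro v
    rw [inner_dirD hgs, hfun, eigen_of_max hφreg he1 (hmax' xbar), ← hl', real_inner_smul_left]
  have hg2 : dirD e1 (dirD e1 (gradient φ)) xbar = 0 := by
    apply ext_inner_right ℝ
    intro v
    have hf2 : (fun y => ⟪dirD e1 (gradient φ) y, v⟫) = dirD e1 (dirD v φ) := by
      funext y
      rw [inner_dirD hgs, hfun]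
    rw [inner_dirD (dirD_smooth hgs e1), hf2, dirD_comm hφreg e1 v,
      dirD_comm (dirD_smooth hφreg e1) e1 v, dirD_eq_zero_of_max h11max, inner_zero_left]
  have hS2 : dirD e1 (dirD e1 S) xbar ≤ 0 := by
    rw [hS, dirD_sum hSk, dirD_sum fun k => dirD_smooth (hSk k) e1]
    refine Finset.sum_nonpos fun k _ => ?_
    set v := rowVec B k
    have : dirD e1 (dirD e1 (dirD v (dirD v φ))) = dirD v (dirD v (dirD e1 (dirD e1 φ))) := by
      rw [dirD_comm (dirD_smooth hφreg v) e1 v, dirD_comm hφreg e1 v,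
        dirD_comm (dirD_smooth (dirD_smooth hφreg e1) v) e1 v,
        dirD_comm (dirD_smooth hφreg e1) e1 v]
    rw [this]
    exact second_test h11s h11max v
  have hcomp := dirD_comp_second hWreg hgs xbar e1 l hg1 hg2
  rw [dirD_sub' hWV hSs, dirD_sub' (dirD_smooth hWV e1) (dirD_smooth hSs e1),
    dirD_sub' hWg hcV, dirD_sub' (dirD_smooth hWg e1) (dirD_smooth hcV e1),
    dirD_const_mul hVreg, dirD_const_mul (dirD_smooth hVreg e1)] at hK2
  beta_reduce at hK2
  rw [hcomp, ← hybar, ← hess_eq hWreg, ← hess_eq hVreg, ← hW11, ← hV11] at hK2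
  have h3 : l ^ 2 * W11 ≤ c⁻¹ * V11 := by linarith
  have h4 := mul_le_mul_of_nonneg_left h3 hc0.le
  rw [mul_inv_cancel_left₀ hc0.ne'] at h4
  linarith
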